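/- arXiv:0710.4346 — 4 statements merged into one kernel-verified Lean document; each statement's English description precedes it below -/
import Mathlib

section
/- Let n and m be positive integers and let T be an integer matrix with n rows such that every column of T is of one of the forms e_i - e_j, e_i, or -e_j for some indices i, j ∈ {1,...,n} (where e_i denotes the i-th standard unit column vector of ℤ^n). Then T is totally unimodular, i.e., every square submatrix of T has determinant 0, 1, or -1. -/
/-- A vector which is the difference of two vectors, each either a standard unit vector or zero. -/
def IsUnitDifference {ι : Type*} [DecidableEq ι] (v : ι → ℤ) : Prop :=
  ∃ a b : Option ι, ∀ l, v l = (if a = some l then 1 else 0) - (if b = some l then 1 else 0)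

lemma exists_option_comp_eq_some_iff {ι κ : Type*} {f : κ → ι} (hf : Function.Injective f)
    (a : Option ι) : ∃ a' : Option κ, ∀ l, a = some (f l) ↔ a' = some l := by
  by_cases h : ∃ l, a = some (f l)
  · obtain ⟨l, rfl⟩ := h
    exact ⟨some l, fun l' => by simp [hf.eq_iff]⟩
  · exact ⟨none, fun l => by simpa using fun hl => h ⟨l, hl⟩⟩

lemma IsUnitDifference.comp {ι κ : Type*} [DecidableEq ι] [DecidableEq κ] {v : ι → ℤ}
    (hv : IsUnitDifference v) {f : κ → ι} (hf : Function.Injective f) :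
    IsUnitDifference (v ∘ f) := by
  obtain ⟨a, b, h⟩ := hv
  obtain ⟨a', ha⟩ := exists_option_comp_eq_some_iff hf a
  obtain ⟨b', hb⟩ := exists_option_comp_eq_some_iff hf b
  exact ⟨a', b', fun l => by simp only [Function.comp_apply, h, ha, hb]⟩

/-- A unit difference whose entries do not sum to zero is a signed unit vector. -/
lemma IsUnitDifference.eq_single_of_sum_ne_zero {ι : Type*} [Fintype ι] [DecidableEq ι]
    {v : ι → ℤ} (hv : IsUnitDifference v) (hs : ∑ l, v l ≠ 0) :
    ∃ i, (v i = 1 ∨ v i = -1) ∧ ∀ l, l ≠ i → v l = 0 := by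
  obtain ⟨a, b, h⟩ := hv
  rcases a with _ | i <;> rcases b with _ | j
  · simp [h] at hs
  · exact ⟨j, by simp [h], fun l hl => by simp [h, hl.symm]⟩
  · exact ⟨i, by simp [h], fun l hl => by simp [h, hl.symm]⟩
  · simp [h] at hs

theorem det_of_isUnitDifference_col {k : ℕ} (A : Matrix (Fin k) (Fin k) ℤ)
    (hA : ∀ c, IsUnitDifference fun l => A l c) : A.det = 0 ∨ A.det = 1 ∨ A.det = -1 := by
  induction k with
  | zero => simp
  | succ k ih =>
    by_cases h : ∀ c, ∑ l, A l c = 0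
    · left
      refine Matrix.exists_vecMul_eq_zero_iff.mp ⟨1, one_ne_zero, ?_⟩
      ext c
      simpa [Matrix.vecMul, dotProduct] using h c
    · push Not at h
      obtain ⟨c, hc⟩ := h
      obtain ⟨i, hi, hz⟩ := (hA c).eq_single_of_sum_ne_zero hc
      have hdet := Matrix.det_succ_column A c
      rw [Finset.sum_eq_single i (fun l _ hl => by simp [hz l hl]) (by simp)] at hdet
      have hminor := ih (A.submatrix i.succAbove c.succAbove)
        fun c' => (hA (c.succAbove c')).comp Fin.succAbove_right_injective
      rw [hdet]
      rcases neg_one_pow_eq_or ℤ (i + c : ℕ) with hp | hp <;>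
        rcases hi with hi | hi <;> rcases hminor with hm | hm | hm <;> simp [hp, hi, hm]

/-- A matrix over ℤ whose every column is of the form `e_i - e_j`, `e_i`, or
`-e_j` is totally unimodular: every square submatrix has determinant `0`, `1`, or `-1`. -/
theorem stmt0 (n m : ℕ) (hn : 0 < n) (hm : 0 < m) (T : Matrix (Fin n) (Fin m) ℤ)
    (hT : ∀ c : Fin m,
      (∃ i j : Fin n, ∀ l, T l c = (if l = i then 1 else 0) - (if l = j then 1 else 0)) ∨
      (∃ i : Fin n, ∀ l, T l c = if l = i then 1 else 0) ∨
      (∃ j : Fin n, ∀ l, T l c = -(if l = j then 1 else 0))) :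
    ∀ (k : ℕ) (f : Fin k → Fin n) (g : Fin k → Fin m),
      Function.Injective f → Function.Injective g →
      (T.submatrix f g).det = 0 ∨ (T.submatrix f g).det = 1 ∨ (T.submatrix f g).det = -1 := by
  intro k f g hf _
  refine det_of_isUnitDifference_col _ fun c => ?_
  refine IsUnitDifference.comp (v := fun l => T l (g c)) ?_ hf
  rcases hT (g c) with ⟨i, j, h⟩ | ⟨i, h⟩ | ⟨j, h⟩
  · exact ⟨some i, some j, fun l => by simp [h, eq_comm]⟩
  · exact ⟨some i, none, fun l => by simp [h, eq_comm]⟩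
  · exact ⟨none, some j, fun l => by simp [h, eq_comm]⟩
end

section
/- Let n be a positive integer, let A ⊆ {1,...,n}, and let R_A = { e_i - e_j : i ∈ {1,...,n}, j ∈ A } ∪ { e_i : i ∈ {1,...,n} } ∪ { -e_j : j ∈ A } ⊆ ℤ^n. Let v_1, ..., v_k ∈ R_A be linearly independent over ℚ. Then every vector x ∈ ℤ^n that lies in the ℚ-linear span of v_1, ..., v_k is an integral linear combination of v_1, ..., v_k; that is, the lattice generated by v_1, ..., v_k over ℤ equals the intersection of their rational linear span with ℤ^n. (In particular, every simplicial cone generated by linearly independent vectors of R_A is unimodular.) -/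
/-- The indicator function of `p`, where the extra point `none` is sent to zero. -/
def optionIndicator {ι : Type*} [DecidableEq ι] (p : Option ι) (l : ι) : ℤ :=
  if p = some l then 1 else 0

/-- Differences of two elements of `{0} ∪ {e_i}`: the columns of a network matrix. -/
def IsNetworkVector {ι : Type*} [DecidableEq ι] (u : ι → ℤ) : Prop :=
  ∃ p q : Option ι, ∀ l, u l = optionIndicator p l - optionIndicator q l

theorem optionIndicator_pivot {ι : Type*} [DecidableEq ι] (i : ι) (q x : Option ι)
    (l : ι) :
    optionIndicator x l
        - optionIndicator x i * (optionIndicator (some i) l - optionIndicator q l) =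
      optionIndicator (if x = some i then q else x) l := by
  by_cases hx : x = some i
  · subst hx
    simp [optionIndicator]
  · simp [optionIndicator, hx]

theorem IsNetworkVector.exists_of_ne_zero {ι : Type*} [DecidableEq ι] {v : ι → ℤ}
    (hv : IsNetworkVector v) {i : ι} (hi : v i ≠ 0) :
    v i * v i = 1 ∧
      ∃ q : Option ι, ∀ l, v i * v l = optionIndicator (some i) l - optionIndicator q l := by
  obtain ⟨p, q, h⟩ := hv
  by_cases hp : p = some i <;> by_cases hq : q = some i
  · simp [h, hp, hq] at hi
  · have hs : v i = 1 := by simp [h, optionIndicator, hp, hq]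
    exact ⟨by simp [hs], q, fun l => by rw [hs, h, hp]; ring⟩
  · have hs : v i = -1 := by simp [h, optionIndicator, hp, hq]
    exact ⟨by simp [hs], p, fun l => by rw [hs, h, hq]; ring⟩
  · simp [h, optionIndicator, hp, hq] at hi

/-- Eliminating the coordinate `i` by means of a network vector preserves network vectors. -/
theorem IsNetworkVector.pivot {ι : Type*} [DecidableEq ι] {u v : ι → ℤ}
    (hu : IsNetworkVector u) (hv : IsNetworkVector v) {i : ι} (hi : v i ≠ 0) :
    IsNetworkVector (fun l => u l - u i * (v i * v l)) := by
  obtain ⟨-, q, hq⟩ := hv.exists_of_ne_zero hi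
  obtain ⟨a, b, hab⟩ := hu
  refine ⟨if a = some i then q else a, if b = some i then q else b, fun l => ?_⟩
  simp only [← optionIndicator_pivot, hq, hab]
  ring

/-- A rational combination of independent network vectors with integral value has integral
coefficients. -/
theorem exists_int_coeff_of_isNetworkVector {ι : Type*} [DecidableEq ι] {k : ℕ}
    (v : Fin k → ι → ℤ) (hv : ∀ t, IsNetworkVector (v t))
    (hli : ∀ g : Fin k → ℚ, (∀ l, ∑ t, g t * v t l = 0) → ∀ t, g t = 0)
    (c : Fin k → ℚ) (hc : ∀ l, ∃ z : ℤ, ∑ t, c t * v t l = z) :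
    ∀ t, ∃ z : ℤ, c t = z := by
  induction k with
  | zero => exact fun t => t.elim0
  | succ k ih =>
    obtain ⟨i, hi⟩ : ∃ i, v 0 i ≠ 0 := by
      by_contra! h
      have := hli (Pi.single 0 1) (fun l => by simp [Fin.sum_univ_succ, h]) 0
      simp at this
    have hs : (v 0 i : ℚ) * v 0 i = 1 := mod_cast ((hv 0).exists_of_ne_zero hi).1
    have hsum (g : Fin k → ℚ) (l : ι) :
        ∑ t, g t * ((v t.succ l - v t.succ i * (v 0 i * v 0 l) : ℤ) : ℚ) =
          ∑ t, g t * v t.succ l - (∑ t, g t * v t.succ i) * (v 0 i * v 0 l) := by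
      rw [Finset.sum_mul, ← Finset.sum_sub_distrib]
      refine Finset.sum_congr rfl fun t _ => ?_
      push_cast
      ring
    have htail : ∀ t : Fin k, ∃ z : ℤ, c t.succ = z := by
      refine ih (fun t l => v t.succ l - v t.succ i * (v 0 i * v 0 l))
        (fun t => (hv t.succ).pivot (hv 0) hi) (fun g hg t => ?_) (fun t => c t.succ)
        (fun l => ?_)
      · have := hli (Fin.cons (-((∑ t, g t * v t.succ i) * v 0 i)) g) (fun l => ?_) t.succ
        · simpa using this
        · have := hg l
          rw [hsum] at this
          simp only [Fin.sum_univ_succ, Fin.cons_zero, Fin.cons_succ]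
          linarith
      · obtain ⟨z, hz⟩ := hc l
        obtain ⟨y, hy⟩ := hc i
        rw [Fin.sum_univ_succ] at hz hy
        refine ⟨z - y * (v 0 i * v 0 l), ?_⟩
        rw [hsum]
        push_cast
        rw [← hz, ← hy]
        linear_combination c 0 * v 0 l * hs
    refine Fin.cases ?_ htail
    choose d hd using htail
    obtain ⟨y, hy⟩ := hc i
    rw [Fin.sum_univ_succ] at hy
    simp only [hd] at hy
    refine ⟨(y - ∑ t, d t * v t.succ i) * v 0 i, ?_⟩
    push_cast
    rw [← hy]
    linear_combination -c 0 * hs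

/-- Linearly independent vectors from an elementary set `R_A` generate a lattice
equal to the intersection of their rational span with `ℤ^n`: every integer vector in the
ℚ-linear span of the `v t` is an integral linear combination of them. -/
theorem stmt1 (n : ℕ) (hn : 0 < n) (A : Set (Fin n)) (k : ℕ)
    (v : Fin k → (Fin n → ℤ))
    (hv : ∀ t : Fin k,
      (∃ i : Fin n, ∃ j ∈ A,
        v t = fun l => (if l = i then 1 else 0) - (if l = j then 1 else 0)) ∨
      (∃ i : Fin n, v t = fun l => if l = i then 1 else 0) ∨
      (∃ j ∈ A, v t = fun l => -(if l = j then 1 else 0)))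
    (hli : LinearIndependent ℚ (fun t : Fin k => fun l : Fin n => ((v t l : ℚ)))) :
    ∀ x : Fin n → ℤ,
      (fun l => (x l : ℚ)) ∈
          Submodule.span ℚ (Set.range (fun t : Fin k => fun l : Fin n => ((v t l : ℚ)))) →
      ∃ c : Fin k → ℤ, x = ∑ t : Fin k, c t • v t := by
  intro x hx
  obtain ⟨c, hc⟩ := (Submodule.mem_span_range_iff_exists_fun ℚ).1 hx
  have hcl (l : Fin n) : ∑ t, c t * (v t l : ℚ) = x l := by
    simpa using congrFun hc l
  have hnet (t : Fin k) : IsNetworkVector (v t) := by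
    rcases hv t with ⟨i, j, -, h⟩ | ⟨i, h⟩ | ⟨j, -, h⟩
    · exact ⟨some i, some j, fun l => by simp [h, optionIndicator, eq_comm]⟩
    · exact ⟨some i, none, fun l => by simp [h, optionIndicator, eq_comm]⟩
    · exact ⟨none, some j, fun l => by simp [h, optionIndicator, eq_comm]⟩
  have hint := exists_int_coeff_of_isNetworkVector v hnet
    (fun g hg => Fintype.linearIndependent_iff.1 hli g (by ext l; simpa using hg l))
    c (fun l => ⟨x l, hcl l⟩)
  choose d hd using hint
  refine ⟨d, funext fun l => ?_⟩
  have h := hcl l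
  simp only [hd] at h
  simp only [Finset.sum_apply, Pi.smul_apply, smul_eq_mul]
  exact_mod_cast h.symm
end

section
/- Let n ≥ 2 be an integer. There exists a polynomial p with rational coefficients such that for every nonnegative integer k, p(k) equals the number of vectors x ∈ ℕ^n with x_1 + ⋯ + x_n = 2k and x_i ≤ k for all i, and every coefficient p_0, p_1, ..., p_{deg p} of p is strictly positive. (That is, the coefficients of the Ehrhart polynomial of the matroid polytope of the uniform matroid U^{2,n} are positive.) -/
open Finset Polynomial

theorem coeff_ascPochhammer_eq_stirlingFirst {R : Type*} [Semiring R] (n k : ℕ) :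
    (ascPochhammer R n).coeff k = (Nat.stirlingFirst n k : R) := by
  induction n generalizing k with
  | zero => cases k <;> simp [Polynomial.coeff_one]
  | succ n ih =>
    rw [ascPochhammer_succ_right, mul_add, coeff_add, coeff_mul_natCast]
    cases k with
    | zero => cases n <;> simp [ih]
    | succ k =>
      rw [coeff_mul_X, ih, ih, Nat.stirlingFirst_succ_succ]
      push_cast
      rw [← Nat.cast_comm, add_comm]

theorem coeff_ascPochhammer_comp_X_add_one {R : Type*} [Semiring R] (n k : ℕ) :
    ((ascPochhammer R n).comp (X + 1)).coeff k = (Nat.stirlingFirst (n + 1) (k + 1) : R) := by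
  rw [← coeff_ascPochhammer_eq_stirlingFirst, ascPochhammer_succ_left, coeff_X_mul]

theorem stirlingFirst_pos {n k : ℕ} (hk : 1 ≤ k) (hkn : k ≤ n) : 0 < Nat.stirlingFirst n k := by
  induction n generalizing k with
  | zero => omega
  | succ n ih =>
    obtain ⟨k, rfl⟩ := Nat.exists_eq_add_of_le' hk
    rw [Nat.stirlingFirst_succ_succ]
    rcases Nat.lt_or_ge k n with h | h
    · have := ih (k := k + 1) (by omega) h
      have : 0 < n * Nat.stirlingFirst n (k + 1) := Nat.mul_pos (by omega) this
      omega
    · obtain rfl : k = n := by omega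
      simp [Nat.stirlingFirst_self]

theorem succ_mul_stirlingFirst_le (n k : ℕ) :
    (n + 1) * Nat.stirlingFirst n k ≤ (k + 1) * Nat.stirlingFirst (n + 1) (k + 1) := by
  induction n generalizing k with
  | zero => cases k <;> simp [Nat.stirlingFirst]
  | succ n ih =>
    rw [Nat.stirlingFirst_succ_succ (n + 1)]
    have h1 := ih k
    cases k with
    | zero => simp
    | succ k =>
      have h2 := ih k
      have h3 := Nat.stirlingFirst_succ_succ n k
      nlinarith

theorem succ_mul_stirlingFirst_add_le (n k : ℕ) :
    (n + 2) * Nat.stirlingFirst (n + 1) k + (n + 1) * Nat.stirlingFirst n k ≤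
      (k + 1) * Nat.stirlingFirst (n + 2) (k + 1) := by
  rw [Nat.stirlingFirst_succ_succ (n + 1)]
  have h1 := succ_mul_stirlingFirst_le n k
  cases k with
  | zero => cases n <;> simp_all [Nat.stirlingFirst]
  | succ k =>
    have h2 := succ_mul_stirlingFirst_le n k
    have h3 := Nat.stirlingFirst_succ_succ n k
    nlinarith

theorem succ_mul_stirlingFirst_lt {n k : ℕ} (hn : 2 ≤ n) (hk : k ≤ n) :
    (n + 1) * Nat.stirlingFirst n k < 2 ^ k * Nat.stirlingFirst (n + 1) (k + 1) := by
  have hpos : 0 < Nat.stirlingFirst (n + 1) (k + 1) := stirlingFirst_pos (by omega) (by omega)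
  obtain ⟨n, rfl⟩ := Nat.exists_eq_add_of_le' hn
  match k with
  | 0 => simpa using hpos
  | 1 =>
    have h := succ_mul_stirlingFirst_add_le (n + 1) 1
    have : 0 < Nat.stirlingFirst (n + 1) 1 := stirlingFirst_pos le_rfl (by omega)
    have : 0 < (n + 1 + 1) * Nat.stirlingFirst (n + 1) 1 := by positivity
    norm_num at h ⊢
    linarith
  | k + 2 =>
    refine (succ_mul_stirlingFirst_le (n + 2) (k + 2)).trans_lt ?_
    refine Nat.mul_lt_mul_of_pos_right ?_ hpos
    have := Nat.lt_two_pow_self (n := k)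
    rw [pow_add]
    omega

theorem card_piAntidiag_univ (ι : Type*) [Fintype ι] [DecidableEq ι] (k : ℕ) :
    #(piAntidiag (univ : Finset ι) k) = (Fintype.card ι).multichoose k := by
  rw [← map_sym_eq_piAntidiag, card_map, sym_univ, card_univ, Sym.card_sym_eq_multichoose]

theorem factorial_mul_multichoose_succ (m k : ℕ) :
    m.factorial * (m + 1).multichoose k = (k + 1).ascFactorial m := by
  rw [Nat.ascFactorial_eq_factorial_mul_choose, Nat.multichoose_eq,
    show m + 1 + k - 1 = k + m by omega, Nat.choose_symm_add]

theorem card_filter_lt_piAntidiag {ι : Type*} [Fintype ι] [DecidableEq ι] (i : ι) (a b : ℕ) :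
    #{x ∈ piAntidiag (univ : Finset ι) (a + (b + 1)) | b < x i} =
      (Fintype.card ι).multichoose a := by
  rw [← card_piAntidiag_univ]
  symm
  refine card_bij (fun x _ ↦ x + Pi.single i (b + 1)) ?_ ?_ ?_
  · intro x hx
    simp only [mem_piAntidiag, mem_univ, implies_true, and_true, mem_filter, Pi.add_apply,
      Pi.single_eq_same, sum_add_distrib, sum_pi_single', if_true] at hx ⊢
    simp [hx]
    omega
  · intro x _ y _ h
    exact add_right_cancel h
  · intro x hx
    simp only [mem_piAntidiag, mem_univ, implies_true, and_true, mem_filter] at hx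
    have hle : Pi.single i (b + 1) ≤ x := by
      intro j
      by_cases hj : j = i
      · subst hj; simpa using hx.2
      · simp [hj]
    refine ⟨x - Pi.single i (b + 1), ?_, tsub_add_cancel_of_le hle⟩
    have h := congrArg (fun f : ι → ℕ ↦ ∑ j, f j) (tsub_add_cancel_of_le hle)
    simp only [Pi.add_apply, sum_add_distrib, hx.1] at h
    simp at h
    simpa using h

theorem card_filter_exists_lt_piAntidiag {ι : Type*} [Fintype ι] [DecidableEq ι] (k : ℕ)
    [DecidablePred fun x : ι → ℕ ↦ ∃ i, k + 1 < x i] :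
    #{x ∈ piAntidiag (univ : Finset ι) (2 * (k + 1)) | ∃ i, k + 1 < x i} =
      Fintype.card ι * (Fintype.card ι).multichoose k := by
  have h : {x ∈ piAntidiag (univ : Finset ι) (2 * (k + 1)) | ∃ i, k + 1 < x i} =
      univ.biUnion fun i ↦ {x ∈ piAntidiag (univ : Finset ι) (k + (k + 1 + 1)) | k + 1 < x i} := by
    ext x
    simp [show 2 * (k + 1) = k + (k + 1 + 1) by ring]
  rw [h, card_biUnion]
  · simp [card_filter_lt_piAntidiag]
  · intro i _ j _ hij
    refine Finset.disjoint_left.2 ?_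
    intro x hi hj
    simp only [mem_filter, mem_piAntidiag, mem_univ, implies_true, and_true] at hi hj
    have := sum_le_sum_of_subset (f := x) (subset_univ {i, j})
    have hsum : ∑ l, x l = k + (k + 1 + 1) := hi.1
    rw [sum_pair hij, hsum] at this
    omega

theorem factorial_mul_ncard_add {m : ℕ} (hm : 1 ≤ m) (k : ℕ) :
    m.factorial * Set.ncard {x : Fin (m + 1) → ℕ | (∑ i, x i) = 2 * k ∧ ∀ i, x i ≤ k} +
      (m + 1) * k.ascFactorial m = (2 * k + 1).ascFactorial m := by
  have h : {x : Fin (m + 1) → ℕ | (∑ i, x i) = 2 * k ∧ ∀ i, x i ≤ k} =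
      ({x ∈ piAntidiag (univ : Finset (Fin (m + 1))) (2 * k) | ¬ ∃ i, k < x i} :
        Finset (Fin (m + 1) → ℕ)) := by
    ext x
    simp
  rw [h, Set.ncard_coe_finset]
  have key := card_filter_add_card_filter_not
    (s := piAntidiag (univ : Finset (Fin (m + 1))) (2 * k)) (fun x ↦ ∃ i, k < x i)
  rw [card_piAntidiag_univ, Fintype.card_fin] at key
  rw [← factorial_mul_multichoose_succ m (2 * k), ← key]
  cases k with
  | zero =>
    obtain ⟨m, rfl⟩ := Nat.exists_eq_add_of_le' hm
    simp [Nat.zero_ascFactorial]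
  | succ k =>
    rw [card_filter_exists_lt_piAntidiag, Fintype.card_fin, ← factorial_mul_multichoose_succ m k]
    simp
    ring

/-- The Ehrhart polynomial of the matroid polytope of the uniform matroid
`U^{2,n}` has strictly positive coefficients. -/
theorem stmt4 (n : ℕ) (hn : 2 ≤ n) :
    ∃ p : Polynomial ℚ,
      (∀ k : ℕ, p.eval (k : ℚ) =
        Set.ncard {x : Fin n → ℕ | (∑ i, x i) = 2 * k ∧ ∀ i, x i ≤ k}) ∧
      (∀ i ≤ p.natDegree, 0 < p.coeff i) := by
  obtain ⟨m, rfl⟩ := Nat.exists_eq_add_of_le' (show 1 ≤ n by omega)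
  have hm : 1 ≤ m := by omega
  have hfac : (0 : ℚ) < (m.factorial : ℚ)⁻¹ := by positivity
  set p : ℚ[X] := C (m.factorial : ℚ)⁻¹ * (((ascPochhammer ℚ m).comp (X + 1)).comp (C 2 * X) -
    C (m + 1 : ℚ) * ascPochhammer ℚ m) with hp
  have hcoeff (i : ℕ) : p.coeff i = (m.factorial : ℚ)⁻¹ *
      (((2 ^ i * Nat.stirlingFirst (m + 1) (i + 1) : ℕ) : ℚ) -
        ((m + 1) * Nat.stirlingFirst m i : ℕ)) := by
    rw [hp, coeff_C_mul, coeff_sub, comp_C_mul_X_coeff, coeff_C_mul,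
      coeff_ascPochhammer_comp_X_add_one, coeff_ascPochhammer_eq_stirlingFirst]
    push_cast
    ring
  refine ⟨p, fun k ↦ ?_, fun i hi ↦ ?_⟩
  · have h := congrArg (Nat.cast (R := ℚ)) (factorial_mul_ncard_add hm k)
    push_cast at h
    have e1 := ascPochhammer_nat_eq_natCast_ascFactorial ℚ k m
    have e2 := ascPochhammer_nat_eq_natCast_ascFactorial ℚ (2 * k + 1) m
    push_cast at e2
    have hne : (m.factorial : ℚ) ≠ 0 := by positivity
    simp only [hp, eval_mul, eval_C, eval_sub, eval_comp, eval_add, eval_X, eval_one, e1, e2]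
    rw [inv_mul_eq_iff_eq_mul₀ hne]
    linarith
  · rcases hm.eq_or_lt with rfl | hm2
    · have hdeg : p.natDegree ≤ 0 := by
        rw [natDegree_le_iff_coeff_eq_zero]
        intro j hj
        rw [hcoeff]
        obtain rfl | hj : j = 1 ∨ 1 < j := by omega
        · simp [Nat.stirlingFirst]
        · simp [Nat.stirlingFirst_eq_zero_of_lt hj,
            Nat.stirlingFirst_eq_zero_of_lt (Nat.succ_lt_succ hj)]
      obtain rfl : i = 0 := by omega
      rw [hcoeff]
      simp [Nat.stirlingFirst]
    · have hdeg : p.natDegree ≤ m := by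
        rw [natDegree_le_iff_coeff_eq_zero]
        intro j hj
        rw [hcoeff]
        simp [Nat.stirlingFirst_eq_zero_of_lt hj,
          Nat.stirlingFirst_eq_zero_of_lt (Nat.succ_lt_succ hj)]
      rw [hcoeff]
      refine mul_pos hfac (sub_pos.2 ?_)
      exact_mod_cast succ_mul_stirlingFirst_lt hm2 (hi.trans hdeg)
end

section
/- Let n ≥ 3 be an integer and define the sequence h_0, h_1, ..., h_{⌊n/2⌋} by h_0 = 1, h_1 = C(n,2) − n, and h_l = C(n,2l) for 2 ≤ l ≤ ⌊n/2⌋. Then this sequence (which is the h*-vector of the matroid polytope of the uniform matroid U^{2,n}) is unimodal: there exists an index p with h_0 ≤ h_1 ≤ ⋯ ≤ h_p and h_p ≥ h_{p+1} ≥ ⋯ ≥ h_{⌊n/2⌋}. -/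
theorem Nat.choose_le_choose_of_le_of_le_half {n a b : ℕ} (hab : a ≤ b) (hb : b ≤ n / 2) :
    n.choose a ≤ n.choose b := by
  induction b, hab using Nat.le_induction with
  | base => exact le_rfl
  | succ k _ ih => exact (ih (by omega)).trans (Nat.choose_le_succ_of_lt_half_left (by omega))

theorem Nat.choose_le_choose_of_le_of_add_le {n a b : ℕ} (hab : a ≤ b) (h : a + b ≤ n) :
    n.choose a ≤ n.choose b := by
  by_cases hb : b ≤ n / 2
  · exact Nat.choose_le_choose_of_le_of_le_half hab hb
  · rw [← Nat.choose_symm (show b ≤ n by omega)]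
    exact Nat.choose_le_choose_of_le_of_le_half (by omega) (by omega)

theorem Nat.choose_le_choose_of_le_of_le_add {n a b : ℕ} (hab : a ≤ b) (hb : b ≤ n)
    (h : n ≤ a + b) : n.choose b ≤ n.choose a := by
  rw [← Nat.choose_symm hb, ← Nat.choose_symm (hab.trans hb)]
  exact Nat.choose_le_choose_of_le_of_add_le (by omega) (by omega)

/-- The h*-vector `(1, C(n,2) − n, C(n,4), C(n,6), ..., C(n, 2⌊n/2⌋))` of the
matroid polytope of the uniform matroid `U^{2,n}` is unimodal. -/
theorem stmt11 (n : ℕ) (hn : 3 ≤ n)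
    (h : ℕ → ℤ)
    (hh : ∀ l, h l = if l = 0 then 1 else if l = 1 then (n.choose 2 : ℤ) - n
      else (n.choose (2 * l) : ℤ)) :
    ∃ p : ℕ, p ≤ n / 2 ∧
      (∀ i, 0 < i → i ≤ p → h (i - 1) ≤ h i) ∧
      (∀ j, p ≤ j → j < n / 2 → h (j + 1) ≤ h j) := by
  have h0 : h 0 = 1 := by simp [hh]
  have h1 : h 1 = (n.choose 2 : ℤ) - n := by simp [hh]
  have h2 : ∀ l, 2 ≤ l → h l = n.choose (2 * l) := fun l hl => by
    rw [hh, if_neg (by omega), if_neg (by omega)]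
  obtain rfl | hn4 : n = 3 ∨ 4 ≤ n := by omega
  · refine ⟨0, by omega, by omega, fun j _ hj => ?_⟩
    obtain rfl : j = 0 := by omega
    simp [h0, h1, Nat.choose]
  refine ⟨(n + 2) / 4, by omega, fun i hi hip => ?_, fun j hpj hj => ?_⟩
  · obtain rfl | rfl | hi3 : i = 1 ∨ i = 2 ∨ 3 ≤ i := by omega
    · obtain ⟨m, rfl⟩ := Nat.exists_eq_add_of_le hn4
      have hm : (4 + m).choose 2 * 2 = (4 + m) * (3 + m) := by
        rw [Nat.choose_two_right, Nat.div_mul_cancel (Nat.two_dvd_mul_sub_one _)]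
        congr 1
        omega
      rw [h0, h1]
      zify at hm
      push_cast
      nlinarith
    · have hle := Nat.choose_le_choose_of_le_of_add_le (n := n) (a := 2) (b := 2 * 2)
        (by omega) (by omega)
      rw [h1, h2 2 le_rfl]
      omega
    · rw [h2 _ (by omega), h2 _ (by omega)]
      exact_mod_cast Nat.choose_le_choose_of_le_of_add_le (by omega) (by omega)
  · obtain rfl | hn5 | hn6 : n = 4 ∨ n = 5 ∨ 6 ≤ n := by omega
    · obtain rfl : j = 1 := by omega
      simp [h1, h2, Nat.choose]
    · subst hn5
      obtain rfl : j = 1 := by omega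
      simp [h1, h2, Nat.choose]
    · rw [h2 _ (by omega), h2 _ (by omega)]
      exact_mod_cast Nat.choose_le_choose_of_le_of_le_add (by omega) (by omega) (by omega)
end
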